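/- arXiv:2509.22171 — 3 statements merged into one kernel-verified Lean document; each statement's English description precedes it below -/
import Mathlib

section
/- Let E = ℝ × ℝⁿ × ℝⁿ with coordinates (t, q^i, v^i), κ^i = dq^i − v^i dt, I₁^{vak} = ⟨κ^1,…,κ^n⟩, L : E → ℝ smooth, Θ_L = L dt + (∂L/∂v^i)κ^i, and Adm = {ξ ∈ 𝔛(E) : i_ξ dt = 0 and ℒ_ξκ^i ∈ I₁^{vak} for all i}. Then the variational problem (L dt, (∅, I₁^{vak}), Adm) is dynamically equivalent to the variational problem (Θ_L, (∅, I₁^{vak}), ⟨Adm⟩^{B(π)}): a section of π : E → ℝ over an open interval is a solution of the first if and only if it is a solution of the second. -/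
open MeasureTheory Set Finset
open scoped ContDiff

noncomputable section

namespace VPGeom

variable {E : Type*} [NormedAddCommGroup E] [NormedSpace ℝ E]

/-- A smooth `k`-form in the function model: jointly smooth and, at each point,
given by an alternating multilinear map on the tangent space. -/
def IsFormK (k : ℕ) (α : E → (Fin k → E) → ℝ) : Prop :=
  ContDiff ℝ ∞ (fun p : E × (Fin k → E) => α p.1 p.2) ∧
    ∀ x : E, ∃ m : AlternatingMap ℝ E ℝ (Fin k), ∀ v, α x v = m v

/-- A smooth `1`-form in the function model. -/
def IsForm1 (θ : E → E → ℝ) : Prop :=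
  ContDiff ℝ ∞ (fun p : E × E => θ p.1 p.2) ∧ ∀ x : E, IsLinearMap ℝ (θ x)

/-- A smooth `2`-form in the function model. -/
def IsForm2 (Ω : E → E → E → ℝ) : Prop :=
  ContDiff ℝ ∞ (fun p : E × E × E => Ω p.1 p.2.1 p.2.2) ∧
    ∀ x : E, ∃ m : AlternatingMap ℝ E ℝ (Fin 2), ∀ u v : E, Ω x u v = m ![u, v]

/-- Exterior derivative of a `1`-form on a vector space
(formula with constant extensions of the tangent vectors). -/
def extd1 (θ : E → E → ℝ) : E → E → E → ℝ := fun x u v =>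
  fderiv ℝ (fun y => θ y v) x u - fderiv ℝ (fun y => θ y u) x v

/-- Exterior derivative of a `2`-form on a vector space. -/
def extd2 (Ω : E → E → E → ℝ) : E → E → E → E → ℝ := fun x u v w =>
  fderiv ℝ (fun y => Ω y v w) x u - fderiv ℝ (fun y => Ω y u w) x v +
    fderiv ℝ (fun y => Ω y u v) x w

/-- Lie derivative of a `1`-form along a vector field (on a vector space). -/
def lie1 (ξ : E → E) (θ : E → E → ℝ) : E → E → ℝ := fun x v =>
  fderiv ℝ (fun y => θ y v) x (ξ x) + θ x (fderiv ℝ ξ x v)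

/-- Wedge product of two `1`-forms. -/
def wedge11 (α β : E → E → ℝ) : E → E → E → ℝ := fun x u v =>
  α x u * β x v - α x v * β x u

/-- Wedge product of a `2`-form with a `1`-form. -/
def wedge21 (β : E → E → E → ℝ) (α : E → E → ℝ) : E → E → E → E → ℝ := fun x u v w =>
  β x u v * α x w - β x u w * α x v + β x v w * α x u

/-- Wedge product of a `1`-form with a `2`-form. -/
def wedge12 (α : E → E → ℝ) (β : E → E → E → ℝ) : E → E → E → E → ℝ := fun x u v w =>
  α x u * β x v w - α x v * β x u w + α x w * β x u v

/-- Interior product of a vector field with a `2`-form. -/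
def iota2 (ξ : E → E) (Ω : E → E → E → ℝ) : E → E → ℝ := fun x v => Ω x (ξ x) v

/-- `γ` is a smooth local section, over the open interval `I`, of the bundle over `ℝ`
whose projection ("time coordinate") is `T`. -/
structure IsSection (T : E → ℝ) (γ : ℝ → E) (I : Set ℝ) : Prop where
  isOpen : IsOpen I
  ordConnected : I.OrdConnected
  nonempty : I.Nonempty
  smooth : ContDiffOn ℝ ∞ γ I
  proj : ∀ t ∈ I, T (γ t) = t

/-- Membership in the `C^∞(E)`-ideal generated by a set of functions. -/
def InIdeal (I₀ : Set (E → ℝ)) (h : E → ℝ) : Prop :=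
  ∃ (m : ℕ) (f : Fin m → E → ℝ) (g : Fin m → E → ℝ),
    (∀ j, ContDiff ℝ ∞ (f j)) ∧ (∀ j, g j ∈ I₀) ∧ h = fun x => ∑ j, f j x * g j x

end VPGeom
namespace VPGeom

/-- `E = J¹ρ ≅ ℝ × ℝⁿ × ℝⁿ` with coordinates `(t, qⁱ, vⁱ)`. -/
abbrev E8 (n : ℕ) := ℝ × (Fin n → ℝ) × (Fin n → ℝ)

/-- The Cartan 1-forms `κⁱ = dqⁱ - vⁱ dt`. -/
def kap (n : ℕ) (i : Fin n) : E8 n → E8 n → ℝ := fun x w => w.2.1 i - x.2.2 i * w.1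

/-- `∂L/∂vⁱ`. -/
def dLv (n : ℕ) (L : E8 n → ℝ) (i : Fin n) : E8 n → ℝ := fun x =>
  fderiv ℝ L x ((0 : ℝ), (0 : Fin n → ℝ), Pi.single i 1)

/-- The Poincaré–Cartan 1-form `Θ_L = L dt + (∂L/∂vⁱ) κⁱ`. -/
def ThetaL (n : ℕ) (L : E8 n → ℝ) : E8 n → E8 n → ℝ := fun x w =>
  L x * w.1 + ∑ i, dLv n L i x * kap n i x w

end VPGeom
namespace VPGeom

/-- Membership in the `C^∞(E)`-module `I₁ᵛᵃᵏ = ⟨κ¹,…,κⁿ⟩` generated by the Cartan forms. -/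
def InKapSpan (n : ℕ) (α : E8 n → E8 n → ℝ) : Prop :=
  ∃ f : Fin n → E8 n → ℝ, (∀ j, ContDiff ℝ ∞ (f j)) ∧
    ∀ x w, α x w = ∑ j, f j x * kap n j x w

/-- The admissible variations for the vakonomically implemented holonomy constraints:
vertical smooth vector fields `ξ` with `ℒ_ξ κⁱ ∈ I₁ᵛᵃᵏ` for all `i`. -/
def AdmHol (n : ℕ) : Set (E8 n → E8 n) :=
  {ξ | ContDiff ℝ ∞ ξ ∧ (∀ x, (ξ x).1 = 0) ∧ ∀ i, InKapSpan n (lie1 ξ (kap n i))}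

/-- `⟨A⟩^{B(π)}`: all finite `B(π)`-linear combinations of elements of `A`. -/
def BSpan (n : ℕ) (A : Set (E8 n → E8 n)) : Set (E8 n → E8 n) :=
  {ξ | ∃ (m : ℕ) (g : Fin m → ℝ → ℝ) (ζ : Fin m → E8 n → E8 n),
    (∀ j, ContDiff ℝ ∞ (g j)) ∧ (∀ j, ζ j ∈ A) ∧ ξ = fun x => ∑ j, g j x.1 • ζ j x}

/-- The π-vertical smooth vector fields `Γ(V(π))` on `E = J¹ρ`. -/
def VertVF8 (n : ℕ) : Set (E8 n → E8 n) :=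
  {ξ | ContDiff ℝ ∞ ξ ∧ ∀ x, (ξ x).1 = 0}

end VPGeom

namespace VPGeom

/-- Solution sections of a variational problem `(θ, (∅, I₁ᵛᵃᵏ), A)` on `J¹ρ`. -/
def IsVPSolHol (n : ℕ) (θ : E8 n → E8 n → ℝ) (A : Set (E8 n → E8 n))
    (γ : ℝ → E8 n) (I : Set ℝ) : Prop :=
  IsSection Prod.fst γ I ∧
  (∀ α : E8 n → E8 n → ℝ, InKapSpan n α → ∀ t ∈ I, α (γ t) (deriv γ t) = 0) ∧
  ∀ K : Set ℝ, IsCompact K → K ⊆ I →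
    ∀ ξ ∈ A, (∀ t ∈ frontier K, ξ (γ t) = 0) →
      ∫ t in K, lie1 ξ θ (γ t) (deriv γ t) = 0


section Aux

open Filter Topology

lemma countable_frontier_deriv_ne_zero {f f' : ℝ → ℝ} {K : Set ℝ}
    (hf : ∀ t ∈ K, HasDerivAt f (f' t) t) (hK : IsClosed K) (h0 : ∀ t ∈ frontier K, f t = 0) :
    {t ∈ frontier K | f' t ≠ 0}.Countable := by
  refine countable_setOfPred_isolated_right_within (s := frontier K) |>.mono ?_
  rintro t ⟨htK, ht⟩
  refine ⟨htK, ?_⟩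
  have hne : ∀ᶠ z in 𝓝[>] t, f z ≠ 0 :=
    ((hf t (hK.frontier_subset htK)).eventually_ne ht).filter_mono
      (nhdsWithin_mono _ fun z hz => ne_of_gt hz)
  rw [Set.inter_comm, nhdsWithin_inter', ← disjoint_iff, disjoint_principal_right]
  filter_upwards [hne] with z hz hzK using hz (h0 z hzK)

/-- The integral of a derivative over a compact set vanishes as soon as the primitive vanishes
on the frontier of that set. -/
lemma integral_deriv_eq_zero_of_frontier {f f' : ℝ → ℝ} {K : Set ℝ} (hK : IsCompact K)
    (hf : ∀ t ∈ K, HasDerivAt f (f' t) t) (hf' : IntegrableOn f' K)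
    (h0 : ∀ t ∈ frontier K, f t = 0) : ∫ t in K, f' t = 0 := by
  obtain ⟨R, hR⟩ := hK.isBounded.subset_ball 0
  rw [Real.ball_eq_Ioo] at hR
  simp only [zero_sub, zero_add] at hR
  rcases K.eq_empty_or_nonempty with rfl | ⟨t₀, ht₀⟩
  · simp
  have hle : -R ≤ R := ((hR ht₀).1.trans (hR ht₀).2).le
  have hder : ∀ t ∈ Set.Ioo (-R) R \ {t ∈ frontier K | f' t ≠ 0},
      HasDerivAt (K.indicator f) (K.indicator f' t) t := by
    rintro t ⟨-, ht⟩
    by_cases htK : t ∈ K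
    · rw [indicator_of_mem htK]
      by_cases hti : t ∈ interior K
      · refine (hf t htK).congr_of_eventuallyEq ?_
        filter_upwards [mem_interior_iff_mem_nhds.1 hti] with z hz using indicator_of_mem hz f
      · have htf : t ∈ frontier K := ⟨subset_closure htK, hti⟩
        have hft : f' t = 0 := by
          by_contra h
          exact ht ⟨htf, h⟩
        have hd := hf t htK
        rw [hft, hasDerivAt_iff_isLittleO] at hd ⊢
        refine (Asymptotics.isBigO_of_le _ fun z => ?_).trans_isLittleO hd
        rw [indicator_of_mem htK, h0 t htf]
        simpa using norm_indicator_le_norm_self f z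
    · rw [indicator_of_notMem htK]
      refine (hasDerivAt_const t (0 : ℝ)).congr_of_eventuallyEq ?_
      filter_upwards [hK.isClosed.isOpen_compl.mem_nhds htK] with z hz
        using indicator_of_notMem hz f
  have hcont : Continuous (K.indicator f) := by
    refine continuous_indicator h0 fun t ht => ?_
    rw [hK.isClosed.closure_eq] at ht
    exact (hf t ht).continuousAt.continuousWithinAt
  have hint : Integrable (K.indicator f') := hf'.integrable_indicator hK.measurableSet
  have key := integral_eq_of_hasDerivAt_off_countable_of_le (K.indicator f) (K.indicator f') hle
    (countable_frontier_deriv_ne_zero hf hK.isClosed h0) hcont.continuousOn hder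
    hint.intervalIntegrable
  rw [indicator_of_notMem (fun h => lt_irrefl _ (hR h).2),
    indicator_of_notMem (fun h => lt_irrefl _ (hR h).1), sub_zero,
    intervalIntegral.integral_of_le hle, setIntegral_indicator hK.measurableSet,
    Set.inter_eq_right.2 (hR.trans Set.Ioo_subset_Ioc_self)] at key
  exact key

variable {n : ℕ} {L : E8 n → ℝ}

lemma contDiff_dLv (hL : ContDiff ℝ ∞ L) (i : Fin n) : ContDiff ℝ ∞ (dLv n L i) := by
  unfold dLv
  exact (hL.fderiv_right (by simp)).clm_apply contDiff_const

lemma hasFDerivAt_kap (i : Fin n) (x w : E8 n) :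
    HasFDerivAt (fun y : E8 n => kap n i y w)
      (-(w.1 • ((ContinuousLinearMap.proj i).comp ((ContinuousLinearMap.snd ℝ _ _).comp
        (ContinuousLinearMap.snd ℝ ℝ ((Fin n → ℝ) × (Fin n → ℝ))))))) x := by
  have h : HasFDerivAt (fun y : E8 n => y.2.2 i) ((ContinuousLinearMap.proj i).comp
      ((ContinuousLinearMap.snd ℝ _ _).comp
        (ContinuousLinearMap.snd ℝ ℝ ((Fin n → ℝ) × (Fin n → ℝ))))) x :=
    ((ContinuousLinearMap.proj i).comp ((ContinuousLinearMap.snd ℝ _ _).comp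
      (ContinuousLinearMap.snd ℝ ℝ ((Fin n → ℝ) × (Fin n → ℝ))))).hasFDerivAt
  exact (h.mul_const w.1).const_sub (w.2.1 i)

lemma fderiv_fst_eq_zero {ξ : E8 n → E8 n} (hξ : ContDiff ℝ ∞ ξ) (hv : ∀ x, (ξ x).1 = 0)
    (x w : E8 n) : (fderiv ℝ ξ x w).1 = 0 := by
  have h := ((hξ.differentiable (by simp)) x).hasFDerivAt.fst
  have h0 : (fun x => (ξ x).1) = fun _ => (0 : ℝ) := funext hv
  rw [h0] at h
  exact congrArg (fun A : E8 n →L[ℝ] ℝ => A w) (h.unique (hasFDerivAt_const 0 x))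

lemma lie1_kap {ξ : E8 n → E8 n} (hξ : ξ ∈ VertVF8 n) (i : Fin n) (x w : E8 n) :
    lie1 ξ (kap n i) x w = (fderiv ℝ ξ x w).2.1 i - (ξ x).2.2 i * w.1 := by
  rw [lie1, (hasFDerivAt_kap i x w).fderiv, kap, fderiv_fst_eq_zero hξ.1 hξ.2]
  simp
  ring

lemma lie1_lagrangian (hL : ContDiff ℝ ∞ L) {ξ : E8 n → E8 n} (hξ : ξ ∈ VertVF8 n)
    (x w : E8 n) : lie1 ξ (fun x w => L x * w.1) x w = fderiv ℝ L x (ξ x) * w.1 := by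
  have h := ((hL.differentiable (by simp)) x).hasFDerivAt.mul_const w.1
  rw [lie1, h.fderiv, fderiv_fst_eq_zero hξ.1 hξ.2]
  simp [mul_comm]

lemma lie1_ThetaL (hL : ContDiff ℝ ∞ L) {ξ : E8 n → E8 n} (hξ : ξ ∈ VertVF8 n)
    {x w : E8 n} (hk : ∀ i, kap n i x w = 0) :
    lie1 ξ (ThetaL n L) x w =
      lie1 ξ (fun x w => L x * w.1) x w + ∑ i, dLv n L i x * lie1 ξ (kap n i) x w := by
  have h := (((hL.differentiable (by simp)) x).hasFDerivAt.mul_const w.1).add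
    (HasFDerivAt.fun_sum (u := Finset.univ) fun i _ =>
      (((contDiff_dLv hL i).differentiable (by simp)) x).hasFDerivAt.mul (hasFDerivAt_kap i x w))
  rw [lie1_lagrangian hL hξ, lie1]
  erw [h.fderiv]
  simp only [ThetaL, lie1, (hasFDerivAt_kap _ x w).fderiv, fderiv_fst_eq_zero hξ.1 hξ.2, hk]
  simp [mul_add, Finset.sum_add_distrib, mul_comm, add_assoc]

/-- `∂L/∂qⁱ`. -/
def dLq (n : ℕ) (L : E8 n → ℝ) (i : Fin n) : E8 n → ℝ := fun x =>
  fderiv ℝ L x ((0 : ℝ), Pi.single i 1, (0 : Fin n → ℝ))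

lemma contDiff_dLq (hL : ContDiff ℝ ∞ L) (i : Fin n) : ContDiff ℝ ∞ (dLq n L i) := by
  unfold dLq
  exact (hL.fderiv_right (by simp)).clm_apply contDiff_const

lemma fderiv_apply_vertical (x w : E8 n) (hw : w.1 = 0) :
    fderiv ℝ L x w = ∑ i, (dLq n L i x * w.2.1 i + dLv n L i x * w.2.2 i) := by
  have h : w = ∑ i, (w.2.1 i • ((0 : ℝ), Pi.single i (1 : ℝ), (0 : Fin n → ℝ)) +
      w.2.2 i • ((0 : ℝ), (0 : Fin n → ℝ), Pi.single i (1 : ℝ))) := by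
    refine Prod.ext ?_ (Prod.ext ?_ ?_)
    · simp [hw, Prod.fst_sum]
    · ext j
      simp [Prod.fst_sum, Prod.snd_sum, Finset.sum_apply, Pi.single_apply]
    · ext j
      simp [Prod.snd_sum, Finset.sum_apply, Pi.single_apply]
  conv_lhs => rw [h]
  simp only [map_sum, map_add, map_smul, smul_eq_mul, dLq, dLv, mul_comm]

lemma hasFDerivAt_component {ξ : E8 n → E8 n} (hξ : ContDiff ℝ ∞ ξ) (i : Fin n) (x : E8 n) :
    HasFDerivAt (fun y => (ξ y).2.1 i)
      ((ContinuousLinearMap.proj i).comp ((ContinuousLinearMap.fst ℝ _ _).comp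
        ((ContinuousLinearMap.snd ℝ ℝ ((Fin n → ℝ) × (Fin n → ℝ))).comp (fderiv ℝ ξ x)))) x :=
  (hasFDerivAt_pi'.1 ((hξ.differentiable (by simp)) x).hasFDerivAt.snd.fst) i

lemma contDiff_component {ξ : E8 n → E8 n} (hξ : ContDiff ℝ ∞ ξ) (i : Fin n) :
    ContDiff ℝ ∞ (fun y => (ξ y).2.1 i) :=
  contDiff_pi.1 hξ.snd.fst i

lemma inKapSpan_kap (i : Fin n) : InKapSpan n (kap n i) :=
  ⟨fun j _ => if j = i then 1 else 0, fun _ => contDiff_const, fun x w => by simp⟩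

lemma AdmHol_subset_VertVF8 : AdmHol n ⊆ VertVF8 n := fun _ h => ⟨h.1, h.2.1⟩

lemma AdmHol_subset_BSpan : AdmHol n ⊆ BSpan n (AdmHol n) := fun ξ h =>
  ⟨1, fun _ _ => 1, fun _ => ξ, fun _ => contDiff_const, fun _ => h, by simp⟩

lemma BSpan_subset_VertVF8 : BSpan n (AdmHol n) ⊆ VertVF8 n := by
  rintro _ ⟨m, g, ζ, hg, hζ, rfl⟩
  refine ⟨ContDiff.sum fun j _ => ((hg j).comp contDiff_fst).smul (hζ j).1, fun x => ?_⟩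
  simp [Prod.fst_sum, (hζ _).2.1 x]

/-- The holonomic prolongation of the time-dependent variation `g(t) ∂/∂qⁱ`. -/
def prolong (n : ℕ) (i : Fin n) (g : ℝ → ℝ) : E8 n → E8 n := fun x =>
  (0, g x.1 • Pi.single i 1, deriv g x.1 • Pi.single i 1)

lemma contDiff_prolong (i : Fin n) {g : ℝ → ℝ} (hg : ContDiff ℝ ∞ g) :
    ContDiff ℝ ∞ (prolong n i g) := by
  have hg' : ContDiff ℝ ∞ (deriv g) := (contDiff_infty_iff_deriv.1 hg).2
  exact contDiff_const.prodMk (((hg.comp contDiff_fst).smul contDiff_const).prodMk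
    ((hg'.comp contDiff_fst).smul contDiff_const))

lemma fderiv_prolong (i j : Fin n) {g : ℝ → ℝ} (hg : ContDiff ℝ ∞ g) (x w : E8 n) :
    (fderiv ℝ (prolong n i g) x w).2.1 j = deriv g x.1 * w.1 * (Pi.single i 1 : Fin n → ℝ) j := by
  have h1 := hasFDerivAt_component (contDiff_prolong (n := n) i hg) j x
  have h2 : HasFDerivAt (fun y : E8 n => (prolong n i g y).2.1 j) _ x :=
    ((((hg.differentiable (by simp)) x.1).hasDerivAt.comp_hasFDerivAt x
      (hasFDerivAt_fst (𝕜 := ℝ) (p := x))).mul_const ((Pi.single i 1 : Fin n → ℝ) j))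
  have := congrArg (fun A : E8 n →L[ℝ] ℝ => A w) (h1.unique h2)
  simp only [ContinuousLinearMap.comp_apply] at this
  refine Eq.trans this ?_
  simp [mul_comm]

lemma prolong_mem_AdmHol (i : Fin n) {g : ℝ → ℝ} (hg : ContDiff ℝ ∞ g) :
    prolong n i g ∈ AdmHol n := by
  refine ⟨contDiff_prolong i hg, fun _ => rfl, fun j => ⟨0, fun _ => contDiff_const, ?_⟩⟩
  intro x w
  rw [lie1_kap ⟨contDiff_prolong i hg, fun _ => rfl⟩, fderiv_prolong i j hg]
  simp [prolong]
  ring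

section Curve

variable {γ : ℝ → E8 n} {I : Set ℝ}

lemma IsSection.hasDerivAt (hγ : IsSection Prod.fst γ I) {t : ℝ} (ht : t ∈ I) :
    HasDerivAt γ (deriv γ t) t :=
  ((hγ.smooth.differentiableOn (by simp)).differentiableAt (hγ.isOpen.mem_nhds ht)).hasDerivAt

lemma IsSection.deriv_fst (hγ : IsSection Prod.fst γ I) {t : ℝ} (ht : t ∈ I) :
    (deriv γ t).1 = 1 := by
  have h : HasDerivAt (fun s => (γ s).1) (deriv γ t).1 t := by
    simpa using (hγ.hasDerivAt ht).hasFDerivAt.fst.hasDerivAt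
  refine h.unique ((hasDerivAt_id t).congr_of_eventuallyEq ?_)
  filter_upwards [hγ.isOpen.mem_nhds ht] with s hs using hγ.proj s hs

/-- Along a holonomic section, the Lie derivative of the Poincaré–Cartan form does not see the
velocity components of the variation. -/
lemma lie1_ThetaL_section (hL : ContDiff ℝ ∞ L) (hγ : IsSection Prod.fst γ I)
    {t : ℝ} (ht : t ∈ I) (hk : ∀ i, kap n i (γ t) (deriv γ t) = 0)
    {ξ : E8 n → E8 n} (hξ : ξ ∈ VertVF8 n) :
    lie1 ξ (ThetaL n L) (γ t) (deriv γ t) =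
      ∑ i, (dLq n L i (γ t) * (ξ (γ t)).2.1 i +
        dLv n L i (γ t) * deriv (fun s => (ξ (γ s)).2.1 i) t) := by
  have hd : ∀ i, deriv (fun s => (ξ (γ s)).2.1 i) t = (fderiv ℝ ξ (γ t) (deriv γ t)).2.1 i :=
    fun i => ((hasFDerivAt_component hξ.1 i (γ t)).comp_hasDerivAt t (hγ.hasDerivAt ht)).deriv
  rw [lie1_ThetaL hL hξ hk, lie1_lagrangian hL hξ, fderiv_apply_vertical _ _ (hξ.2 _),
    hγ.deriv_fst ht, mul_one, ← Finset.sum_add_distrib]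
  refine Finset.sum_congr rfl fun i _ => ?_
  rw [hd, lie1_kap hξ, hγ.deriv_fst ht]
  ring

/-- On admissible variations, the Lagrangian form and the Poincaré–Cartan form have the same
first variation along a holonomic section. -/
lemma lie1_lagrangian_eq_lie1_ThetaL (hL : ContDiff ℝ ∞ L) {t : ℝ}
    (hk : ∀ i, kap n i (γ t) (deriv γ t) = 0) {ξ : E8 n → E8 n} (hξ : ξ ∈ AdmHol n) :
    lie1 ξ (fun x w => L x * w.1) (γ t) (deriv γ t) =
      lie1 ξ (ThetaL n L) (γ t) (deriv γ t) := by
  rw [lie1_ThetaL hL (AdmHol_subset_VertVF8 hξ) hk, left_eq_add]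
  refine Finset.sum_eq_zero fun i _ => ?_
  obtain ⟨f, -, hf⟩ := hξ.2.2 i
  simp [hf, hk]

lemma frontier_tsupport_eq_zero {g : ℝ → ℝ} (hg : Continuous g) {t : ℝ}
    (ht : t ∈ frontier (tsupport g)) : g t = 0 := by
  by_contra h
  exact ht.2 (interior_maximal subset_closure hg.isOpen_support h)

lemma frontier_tsupport_deriv_eq_zero {g : ℝ → ℝ} (hg : Continuous (deriv g)) {t : ℝ}
    (ht : t ∈ frontier (tsupport g)) : deriv g t = 0 := by
  by_contra h
  exact ht.2 (interior_maximal support_deriv_subset hg.isOpen_support h)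

/-- The product rule integrated over a compact set on whose frontier one factor vanishes. -/
lemma integral_mul_deriv_of_frontier (hI : IsOpen I) {p a : ℝ → ℝ} (hp : ContDiffOn ℝ ∞ p I)
    (ha : ContDiffOn ℝ ∞ a I) {K : Set ℝ} (hK : IsCompact K) (hKI : K ⊆ I)
    (h0 : ∀ t ∈ frontier K, a t = 0) :
    ∫ t in K, (deriv p t * a t + p t * deriv a t) = 0 := by
  have hd : ∀ {f : ℝ → ℝ}, ContDiffOn ℝ ∞ f I → ∀ t ∈ K, HasDerivAt f (deriv f t) t :=
    fun hf t ht => ((hf.differentiableOn (by simp)).differentiableAt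
      (hI.mem_nhds (hKI ht))).hasDerivAt
  refine integral_deriv_eq_zero_of_frontier (f := fun t => p t * a t) hK
    (fun t ht => (hd hp t ht).mul (hd ha t ht)) ?_ (fun t ht => by simp [h0 t ht])
  refine ContinuousOn.integrableOn_compact hK (ContinuousOn.mono ?_ hKI)
  exact ((hp.continuousOn_deriv_of_isOpen hI (by simp)).mul ha.continuousOn).add
    (hp.continuousOn.mul (ha.continuousOn_deriv_of_isOpen hI (by simp)))

/-- The Euler–Lagrange equations, as a consequence of Hamilton's principle. -/
lemma eulerLagrange_of_isVPSolHol (hL : ContDiff ℝ ∞ L)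
    (h : IsVPSolHol n (fun x w => L x * w.1) (AdmHol n) γ I) (i : Fin n) :
    ∀ᵐ t, t ∈ I → dLq n L i (γ t) - deriv (fun s => dLv n L i (γ s)) t = 0 := by
  obtain ⟨hγ, hJ, hvar⟩ := h
  have hp : ContDiffOn ℝ ∞ (fun s => dLv n L i (γ s)) I :=
    (contDiff_dLv hL i).comp_contDiffOn hγ.smooth
  have hr : ContinuousOn (fun s => dLq n L i (γ s)) I :=
    ((contDiff_dLq hL i).comp_contDiffOn hγ.smooth).continuousOn
  have hp' := hp.continuousOn_deriv_of_isOpen hγ.isOpen (by simp)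
  refine hγ.isOpen.ae_eq_zero_of_integral_contDiff_smul_eq_zero
    ((hr.sub hp').locallyIntegrableOn hγ.isOpen.measurableSet) fun g hg hgc hgI => ?_
  have hg' : Continuous (deriv g) := hg.continuous_deriv (by simp)
  have hEq : ∀ t ∈ tsupport g, lie1 (prolong n i g) (fun x w => L x * w.1) (γ t) (deriv γ t) =
      dLq n L i (γ t) * g t + dLv n L i (γ t) * deriv g t := by
    intro t ht
    rw [lie1_lagrangian hL (AdmHol_subset_VertVF8 (prolong_mem_AdmHol i hg)),
      fderiv_apply_vertical _ _ rfl, hγ.deriv_fst (hgI ht)]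
    simp [prolong, hγ.proj t (hgI ht), Finset.sum_add_distrib, Pi.single_apply]
  have h1 : ∫ t in tsupport g, (dLq n L i (γ t) * g t + dLv n L i (γ t) * deriv g t) = 0 := by
    rw [← hvar _ hgc hgI _ (prolong_mem_AdmHol i hg) fun t ht => ?_]
    · exact (setIntegral_congr_fun (isClosed_tsupport g).measurableSet hEq).symm
    · have hproj := hγ.proj t (hgI ((isClosed_tsupport g).frontier_subset ht))
      simp [prolong, hproj, frontier_tsupport_eq_zero hg.continuous ht,
        frontier_tsupport_deriv_eq_zero hg' ht]
  have h2 := integral_mul_deriv_of_frontier hγ.isOpen hp hg.contDiffOn hgc hgI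
    fun t ht => frontier_tsupport_eq_zero hg.continuous ht
  have hint : ∀ {f : ℝ → ℝ}, ContinuousOn f I → IntegrableOn f (tsupport g) :=
    fun hf => (hf.mono hgI).integrableOn_compact hgc
  have hgd : ContinuousOn (fun t => dLv n L i (γ t) * deriv g t) I :=
    hp.continuousOn.mul hg'.continuousOn
  rw [← setIntegral_eq_integral_of_forall_compl_eq_zero (s := tsupport g) fun t ht => by
    simp [image_eq_zero_of_notMem_tsupport ht]]
  have h3 := integral_sub (hint ((hr.mul hg.continuous.continuousOn).add hgd))
    (hint ((hp'.mul hg.continuous.continuousOn).add hgd))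
  simp only [Pi.add_apply, Pi.mul_apply] at h3
  rw [h1, h2, sub_zero] at h3
  rw [← h3]
  refine integral_congr_ae (Eventually.of_forall fun t => ?_)
  simp only [smul_eq_mul]
  ring

/-- The Euler–Lagrange equations imply that the first variation of the Poincaré–Cartan form
vanishes for every vertical variation. -/
lemma integral_lie1_ThetaL_eq_zero (hL : ContDiff ℝ ∞ L) (hγ : IsSection Prod.fst γ I)
    (hk : ∀ t ∈ I, ∀ i, kap n i (γ t) (deriv γ t) = 0)
    (hEL : ∀ i, ∀ᵐ t, t ∈ I → dLq n L i (γ t) - deriv (fun s => dLv n L i (γ s)) t = 0)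
    {K : Set ℝ} (hK : IsCompact K) (hKI : K ⊆ I) {ξ : E8 n → E8 n} (hξ : ξ ∈ VertVF8 n)
    (h0 : ∀ t ∈ frontier K, ξ (γ t) = 0) :
    ∫ t in K, lie1 ξ (ThetaL n L) (γ t) (deriv γ t) = 0 := by
  have hp : ∀ i, ContDiffOn ℝ ∞ (fun s => dLv n L i (γ s)) I := fun i =>
    (contDiff_dLv hL i).comp_contDiffOn hγ.smooth
  have ha : ∀ i, ContDiffOn ℝ ∞ (fun s => (ξ (γ s)).2.1 i) I := fun i =>
    (contDiff_component hξ.1 i).comp_contDiffOn hγ.smooth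
  calc ∫ t in K, lie1 ξ (ThetaL n L) (γ t) (deriv γ t)
      = ∫ t in K, ∑ i, (deriv (fun s => dLv n L i (γ s)) t * (ξ (γ t)).2.1 i +
          dLv n L i (γ t) * deriv (fun s => (ξ (γ s)).2.1 i) t) := by
        refine setIntegral_congr_ae hK.measurableSet ?_
        filter_upwards [ae_all_iff.2 hEL] with t ht htK
        rw [lie1_ThetaL_section hL hγ (hKI htK) (hk t (hKI htK)) hξ]
        refine Finset.sum_congr rfl fun i _ => ?_
        rw [sub_eq_zero.1 (ht i (hKI htK))]
    _ = 0 := by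
        rw [integral_finsetSum]
        · exact Finset.sum_eq_zero fun i _ =>
            integral_mul_deriv_of_frontier hγ.isOpen (hp i) (ha i) hK hKI
              fun t ht => by simp [h0 t ht]
        · intro i _
          refine ContinuousOn.integrableOn_compact hK (ContinuousOn.mono ?_ hKI)
          exact (((hp i).continuousOn_deriv_of_isOpen hγ.isOpen (by simp)).mul
            (ha i).continuousOn).add ((hp i).continuousOn.mul
              ((ha i).continuousOn_deriv_of_isOpen hγ.isOpen (by simp)))

end Curve

end Aux

/-- The variational problem `(L dt, (∅, I₁ᵛᵃᵏ), Adm)` is dynamically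
equivalent to the variational problem `(Θ_L, (∅, I₁ᵛᵃᵏ), ⟨Adm⟩^{B(π)})`. -/
theorem hamilton_principle_poincare_cartan (n : ℕ) (L : E8 n → ℝ) (hL : ContDiff ℝ ∞ L) :
    ∀ (γ : ℝ → E8 n) (I : Set ℝ),
      IsVPSolHol n (fun x w => L x * w.1) (AdmHol n) γ I ↔
        IsVPSolHol n (ThetaL n L) (BSpan n (AdmHol n)) γ I := by
  intro γ I
  constructor
  · intro h
    exact ⟨h.1, h.2.1, fun K hK hKI ξ hξ h0 => integral_lie1_ThetaL_eq_zero hL h.1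
      (fun t ht i => h.2.1 _ (inKapSpan_kap i) t ht) (eulerLagrange_of_isVPSolHol hL h) hK hKI
      (BSpan_subset_VertVF8 hξ) h0⟩
  · rintro ⟨hγ, hJ, hvar⟩
    refine ⟨hγ, hJ, fun K hK hKI ξ hξ h0 => ?_⟩
    rw [← hvar K hK hKI ξ (AdmHol_subset_BSpan hξ) h0]
    exact setIntegral_congr_fun hK.measurableSet fun t ht =>
      lie1_lagrangian_eq_lie1_ThetaL hL (fun i => hJ _ (inKapSpan_kap i) t (hKI ht)) hξ

end VPGeom
end
end

section
/- Let E = ℝ × ℝⁿ × ℝⁿ × ℝ with coordinates (t, q^i, v^i, s), L : E → ℝ smooth, E_L = (∂L/∂v^i)v^i − L, κ^i = dq^i − v^i dt, and η = ds + E_L dt − (∂L/∂v^i)dq^i. Let E' = E × ℝ^{n+1} with coordinates (p_i, p_s), π' : E' → E the projection, and, denoting by primes pullbacks by π', set Ω_U = dL' ∧ dt + d(p_i κ'^i) + dp_s ∧ η', η̌ = ds − p_i κ'^i − L' dt, and Ω̌ = −dη̌ + dp_s ∧ η̌. Then the GVP (Ω_U, ∅, Γ(V(π∘π'))) is dynamically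 equivalent to the GVP (Ω̌, ∅, Γ(V(π∘π'))): they have exactly the same solution sections. -/
open MeasureTheory Set Finset
open scoped ContDiff

noncomputable section

namespace VPGeom

/-- `E = J¹ρ × ℝ ≅ ℝ × ℝⁿ × ℝⁿ × ℝ` with coordinates `(t, qⁱ, vⁱ, s)`. -/
abbrev E17 (n : ℕ) := ℝ × (Fin n → ℝ) × (Fin n → ℝ) × ℝ

/-- The Cartan 1-forms `κⁱ = dqⁱ - vⁱ dt`. -/
def kap17 (n : ℕ) (i : Fin n) : E17 n → E17 n → ℝ := fun x w => w.2.1 i - x.2.2.1 i * w.1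

/-- `∂L/∂vⁱ`. -/
def dLv17 (n : ℕ) (L : E17 n → ℝ) (i : Fin n) : E17 n → ℝ := fun x =>
  fderiv ℝ L x ((0 : ℝ), (0 : Fin n → ℝ), Pi.single i 1, (0 : ℝ))

/-- The Lagrangian energy `E_L = (∂L/∂vⁱ)vⁱ - L`. -/
def EnL (n : ℕ) (L : E17 n → ℝ) : E17 n → ℝ := fun x =>
  ∑ i, dLv17 n L i x * x.2.2.1 i - L x

/-- `η = ds + E_L dt - (∂L/∂vⁱ) dqⁱ`. -/
def eta17 (n : ℕ) (L : E17 n → ℝ) : E17 n → E17 n → ℝ := fun x w =>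
  w.2.2.2 + EnL n L x * w.1 - ∑ i, dLv17 n L i x * w.2.1 i

/-- The Poincaré–Cartan 1-form `Θ_L = L dt + (∂L/∂vⁱ) κⁱ`. -/
def ThetaL17 (n : ℕ) (L : E17 n → ℝ) : E17 n → E17 n → ℝ := fun x w =>
  L x * w.1 + ∑ i, dLv17 n L i x * kap17 n i x w

end VPGeom

namespace VPGeom

/-- `E' = E × ℝⁿ⁺¹` with additional coordinates `(pᵢ, p_s)`. -/
abbrev E17' (n : ℕ) := E17 n × (Fin n → ℝ) × ℝ

/-- The unified form `Ω_U = dL' ∧ dt + d(pᵢ κ'ⁱ) + dp_s ∧ η'` on `E'`. -/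
def OmegaU17 (n : ℕ) (L : E17 n → ℝ) : E17' n → E17' n → E17' n → ℝ := fun x u v =>
  wedge11 (fun y w => fderiv ℝ (fun z : E17' n => L z.1) y w) (fun _ w => w.1.1) x u v +
    extd1 (fun y w => ∑ i, y.2.1 i * kap17 n i y.1 w.1) x u v +
    wedge11 (fun _ w => w.2.2) (fun y w => eta17 n L y.1 w.1) x u v

/-- `η̌ = ds - pᵢ κ'ⁱ - L' dt` on `E'`. -/
def etaCheck (n : ℕ) (L : E17 n → ℝ) : E17' n → E17' n → ℝ := fun x w =>
  w.1.2.2.2 - ∑ i, x.2.1 i * kap17 n i x.1 w.1 - L x.1 * w.1.1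

/-- `Ω̌ = -dη̌ + dp_s ∧ η̌` on `E'`. -/
def OmegaCheck (n : ℕ) (L : E17 n → ℝ) : E17' n → E17' n → E17' n → ℝ := fun x u v =>
  -extd1 (etaCheck n L) x u v + wedge11 (fun _ w => w.2.2) (etaCheck n L) x u v

/-- Solution sections of an unconstrained GVP `(Ω, ∅, Γ(V(π∘π')))` on `E'`. -/
def IsSolU17 (n : ℕ) (Ω : E17' n → E17' n → E17' n → ℝ)
    (γ' : ℝ → E17' n) (I : Set ℝ) : Prop :=
  IsSection (fun x => x.1.1) γ' I ∧
  ∀ ξ : E17' n → E17' n, ContDiff ℝ ∞ ξ → (∀ x, (ξ x).1.1 = 0) →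
    ∀ t ∈ I, Ω (γ' t) (ξ (γ' t)) (deriv γ' t) = 0

/-- The 1-form `pᵢ κ'ⁱ` on `E'`. -/
def momentumKap (n : ℕ) : E17' n → E17' n → ℝ := fun y w =>
  ∑ i, y.2.1 i * kap17 n i y.1 w.1

/-- The 1-form `η' - η̌ = (pᵢ - ∂L/∂vⁱ) κ'ⁱ` on `E'`. -/
def etaDefect (n : ℕ) (L : E17 n → ℝ) : E17' n → E17' n → ℝ := fun x w =>
  ∑ i, (x.2.1 i - dLv17 n L i x.1) * kap17 n i x.1 w.1

/-- The coordinate vector `∂/∂vʲ` on `E`. -/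
def velocityVec (n : ℕ) (j : Fin n) : E17 n :=
  ((0 : ℝ), (0 : Fin n → ℝ), Pi.single j 1, (0 : ℝ))

lemma differentiable_momentumKap (n : ℕ) (w : E17' n) :
    Differentiable ℝ (fun y : E17' n => momentumKap n y w) := by
  unfold momentumKap kap17
  fun_prop

lemma eta17_eq_etaCheck_add (n : ℕ) (L : E17 n → ℝ) (x w : E17' n) :
    eta17 n L x.1 w.1 = etaCheck n L x w + etaDefect n L x w := by
  have h : etaDefect n L x w = ∑ i, x.2.1 i * kap17 n i x.1 w.1 -
      (∑ i, dLv17 n L i x.1 * w.1.2.1 i -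
        (∑ i, dLv17 n L i x.1 * x.1.2.2.1 i) * w.1.1) := by
    simp only [etaDefect, kap17, Finset.sum_mul, ← Finset.sum_sub_distrib]
    exact Finset.sum_congr rfl fun i _ => by ring
  rw [h]
  simp only [eta17, etaCheck, EnL]
  ring

lemma fderiv_etaCheck (n : ℕ) (L : E17 n → ℝ) (hL : Differentiable ℝ L) (x u w : E17' n) :
    fderiv ℝ (fun y => etaCheck n L y w) x u =
      -fderiv ℝ (fun y => momentumKap n y w) x u -
        fderiv ℝ (fun y : E17' n => L y.1) x u * w.1.1 := by
  have hL' : DifferentiableAt ℝ (fun y : E17' n => L y.1) x := by fun_prop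
  have h := ((differentiable_momentumKap n w x).hasFDerivAt.const_sub w.1.2.2.2).sub
    (hL'.hasFDerivAt.mul_const w.1.1)
  have h' : HasFDerivAt (fun y => etaCheck n L y w) _ x := h
  rw [h'.fderiv]
  simp [mul_comm]

lemma OmegaU17_eq_OmegaCheck_add (n : ℕ) (L : E17 n → ℝ) (hL : Differentiable ℝ L)
    (x u w : E17' n) :
    OmegaU17 n L x u w =
      OmegaCheck n L x u w + wedge11 (fun _ v => v.2.2) (etaDefect n L) x u w := by
  have h : extd1 (fun y v : E17' n => ∑ i, y.2.1 i * kap17 n i y.1 v.1) x u w =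
      extd1 (momentumKap n) x u w := rfl
  simp only [OmegaU17, OmegaCheck, h]
  simp only [extd1, wedge11, fderiv_etaCheck n L hL, eta17_eq_etaCheck_add]
  ring

lemma fderiv_momentumKap_velocityVec (n : ℕ) (x w : E17' n) (j : Fin n) :
    fderiv ℝ (fun y => momentumKap n y w) x (velocityVec n j, 0) = -(x.2.1 j * w.1.1) := by
  rw [← (differentiable_momentumKap n w x).lineDeriv_eq_fderiv]
  have h : ∀ r : ℝ, momentumKap n (x + r • ((velocityVec n j, 0) : E17' n)) w =
      momentumKap n x w - r * (x.2.1 j * w.1.1) := by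
    intro r
    have h' : r * (x.2.1 j * w.1.1) =
        ∑ i, r * (x.2.1 i * ((Pi.single j 1 : Fin n → ℝ) i * w.1.1)) := by
      rw [Finset.sum_eq_single j] <;> simp +contextual
    rw [h', momentumKap, momentumKap, ← Finset.sum_sub_distrib]
    refine Finset.sum_congr rfl fun i _ => ?_
    simp only [kap17, velocityVec, Prod.fst_add, Prod.snd_add, Prod.smul_fst, Prod.smul_snd,
      Pi.add_apply, Pi.smul_apply, smul_eq_mul, smul_zero, add_zero]
    ring
  simp only [lineDeriv, h]
  simp

lemma OmegaU17_velocityVec (n : ℕ) (L : E17 n → ℝ) (hL : Differentiable ℝ L)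
    (x w : E17' n) (j : Fin n) :
    OmegaU17 n L x (velocityVec n j, 0) w = (dLv17 n L j x.1 - x.2.1 j) * w.1.1 := by
  have h : extd1 (fun y v : E17' n => ∑ i, y.2.1 i * kap17 n i y.1 v.1) x
      (velocityVec n j, 0) w = -(x.2.1 j * w.1.1) := by
    have h0 : (fun y : E17' n => momentumKap n y (velocityVec n j, 0)) = fun _ => 0 := by
      funext y
      simp [momentumKap, kap17, velocityVec]
    change extd1 (momentumKap n) x (velocityVec n j, 0) w = _
    rw [extd1, h0, fderiv_momentumKap_velocityVec]
    simp
  have hd : fderiv ℝ (fun z : E17' n => L z.1) x (velocityVec n j, 0) = dLv17 n L j x.1 := by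
    have hc : HasFDerivAt (fun z : E17' n => L z.1) _ x :=
      (hL x.1).hasFDerivAt.comp x hasFDerivAt_fst
    rw [hc.fderiv]
    rfl
  rw [OmegaU17, h]
  simp only [wedge11, hd, eta17]
  simp only [velocityVec, Prod.snd_zero, Pi.zero_apply, mul_zero, Finset.sum_const_zero]
  ring

lemma etaDefect_velocityVec (n : ℕ) (L : E17 n → ℝ) (x : E17' n) (j : Fin n) :
    etaDefect n L x (velocityVec n j, 0) = 0 := by
  simp [etaDefect, kap17, velocityVec]

lemma OmegaCheck_velocityVec (n : ℕ) (L : E17 n → ℝ) (hL : Differentiable ℝ L)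
    (x w : E17' n) (j : Fin n) :
    OmegaCheck n L x (velocityVec n j, 0) w = (dLv17 n L j x.1 - x.2.1 j) * w.1.1 := by
  have h := OmegaU17_eq_OmegaCheck_add n L hL x (velocityVec n j, 0) w
  rw [OmegaU17_velocityVec n L hL] at h
  simpa [wedge11, etaDefect_velocityVec] using h.symm

lemma IsSection.time_deriv {n : ℕ} {γ : ℝ → E17' n} {I : Set ℝ}
    (h : IsSection (fun x : E17' n => x.1.1) γ I) {t : ℝ} (ht : t ∈ I) :
    (deriv γ t).1.1 = 1 := by
  have hI : I ∈ nhds t := h.isOpen.mem_nhds ht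
  have hγ : HasDerivAt γ (deriv γ t) t :=
    ((h.smooth.contDiffAt hI).differentiableAt (by simp)).hasDerivAt
  have h1 : HasDerivAt (fun s => (γ s).1.1) (deriv γ t).1.1 t := hγ.fst.fst
  refine h1.unique ((hasDerivAt_id t).congr_of_eventuallyEq ?_)
  filter_upwards [hI] with s hs using h.proj s hs

/-- If a form agrees with `Ω_U` along the vectors `∂/∂vʲ`, its solution sections
satisfy the Legendre relations `pⱼ = ∂L/∂vʲ`. -/
lemma IsSolU17.legendre {n : ℕ} {L : E17 n → ℝ} {Ω : E17' n → E17' n → E17' n → ℝ}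
    (hΩ : ∀ x w j, Ω x (velocityVec n j, 0) w = (dLv17 n L j x.1 - x.2.1 j) * w.1.1)
    {γ : ℝ → E17' n} {I : Set ℝ} (h : IsSolU17 n Ω γ I) {t : ℝ} (ht : t ∈ I) (j : Fin n) :
    (γ t).2.1 j = dLv17 n L j (γ t).1 := by
  have h' := h.2 (fun _ => (velocityVec n j, 0)) contDiff_const (fun _ => rfl) t ht
  rw [hΩ, h.1.time_deriv ht] at h'
  linarith

lemma OmegaU17_eq_OmegaCheck_of_legendre (n : ℕ) (L : E17 n → ℝ) (hL : Differentiable ℝ L)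
    (x u w : E17' n) (hx : ∀ j, x.2.1 j = dLv17 n L j x.1) :
    OmegaU17 n L x u w = OmegaCheck n L x u w := by
  rw [OmegaU17_eq_OmegaCheck_add n L hL]
  simp [wedge11, etaDefect, hx]

/-- The GVP `(Ω_U, ∅, Γ(V(π∘π')))` is dynamically equivalent to the GVP
`(Ω̌, ∅, Γ(V(π∘π')))`: they have exactly the same solution sections. -/
theorem unified_vs_check_form (n : ℕ) (L : E17 n → ℝ) (hL : ContDiff ℝ ∞ L) :
    ∀ (γ' : ℝ → E17' n) (I : Set ℝ),
      IsSolU17 n (OmegaU17 n L) γ' I ↔ IsSolU17 n (OmegaCheck n L) γ' I := by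
  intro γ I
  have hd : Differentiable ℝ L := hL.differentiable (by simp)
  constructor
  · refine fun h => ⟨h.1, fun ξ hξ hv t ht => ?_⟩
    rw [← OmegaU17_eq_OmegaCheck_of_legendre n L hd _ _ _
      (h.legendre (OmegaU17_velocityVec n L hd) ht)]
    exact h.2 ξ hξ hv t ht
  · refine fun h => ⟨h.1, fun ξ hξ hv t ht => ?_⟩
    rw [OmegaU17_eq_OmegaCheck_of_legendre n L hd _ _ _
      (h.legendre (OmegaCheck_velocityVec n L hd) ht)]
    exact h.2 ξ hξ hv t ht

end VPGeom
end
end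

section
/- Let E' = ℝ × ℝⁿ × ℝⁿ × ℝ × ℝ^{n+1} with coordinates (t, q^i, v^i, s, p_i, p_s), L a smooth function of (t, q^i, v^i, s), κ^i = dq^i − v^i dt, and η̌ = ds − p_i κ^i − L dt. Let x ∈ E' be a point at which p_i = ∂L/∂v^i for all i = 1,…,n and ∂L/∂s ≠ 0. Then there is no tangent vector R ∈ T_x E' such that η̌_x(R) = 1 and i_R (dη̌)_x = 0. In particular, η̌ admits no Reeb vector field (a vector field R with i_Rη̌ = 1 and i_R dη̌ = 0) on any neighbourhood of such a point, so η̌ does not define a precontact structure there. -/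
open MeasureTheory Set Finset
open scoped ContDiff

noncomputable section

namespace VPGeom

/-- `E' = ℝ × ℝⁿ × ℝⁿ × ℝ × ℝⁿ⁺¹` with coordinates `(t, qⁱ, vⁱ, s, pᵢ, p_s)`. -/
abbrev E19 (n : ℕ) := E17 n × (Fin n → ℝ) × ℝ

/-- `η̌ = ds - pᵢ κⁱ - L dt` on `E'` (with `L` depending only on `(t, qⁱ, vⁱ, s)`). -/
def etaCheck19 (n : ℕ) (L : E17 n → ℝ) : E19 n → E19 n → ℝ := fun x w =>
  w.1.2.2.2 - ∑ i, x.2.1 i * kap17 n i x.1 w.1 - L x.1 * w.1.1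

theorem fderiv_etaCheck19_apply {n : ℕ} {L : E17 n → ℝ} {x : E19 n}
    (hL : DifferentiableAt ℝ L x.1) (u w : E19 n) :
    fderiv ℝ (fun y => etaCheck19 n L y w) x u =
      -∑ i, (u.2.1 i * (w.1.2.1 i - x.1.2.2.1 i * w.1.1) - x.2.1 i * (u.1.2.2.1 i * w.1.1)) -
        fderiv ℝ L x.1 u.1 * w.1.1 := by
  have hLx : HasFDerivAt (fun y : E19 n => L y.1)
      ((fderiv ℝ L x.1).comp (ContinuousLinearMap.fst ℝ (E17 n) ((Fin n → ℝ) × ℝ))) x :=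
    hL.hasFDerivAt.comp x hasFDerivAt_fst
  have hp (i : Fin n) : HasFDerivAt (fun y : E19 n => y.2.1 i) _ x :=
    ((ContinuousLinearMap.proj (R := ℝ) (φ := fun _ : Fin n => ℝ) i).comp
      ((ContinuousLinearMap.fst ℝ (Fin n → ℝ) ℝ).comp
        (ContinuousLinearMap.snd ℝ (E17 n) ((Fin n → ℝ) × ℝ)))).hasFDerivAt
  have hv (i : Fin n) : HasFDerivAt (fun y : E19 n => y.1.2.2.1 i) _ x :=
    ((ContinuousLinearMap.proj (R := ℝ) (φ := fun _ : Fin n => ℝ) i).comp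
      ((ContinuousLinearMap.fst ℝ (Fin n → ℝ) ℝ).comp
        ((ContinuousLinearMap.snd ℝ (Fin n → ℝ) ((Fin n → ℝ) × ℝ)).comp
          ((ContinuousLinearMap.snd ℝ ℝ ((Fin n → ℝ) × (Fin n → ℝ) × ℝ)).comp
            (ContinuousLinearMap.fst ℝ (E17 n) ((Fin n → ℝ) × ℝ)))))).hasFDerivAt
  have h := ((HasFDerivAt.fun_sum (u := Finset.univ) fun i _ =>
    (hp i).mul (((hv i).mul_const w.1.1).const_sub (w.1.2.1 i))).const_sub w.1.2.2.2).sub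
      (hLx.mul_const w.1.1)
  have h' : HasFDerivAt (fun y => etaCheck19 n L y w) _ x := h
  rw [h'.fderiv]
  simp only [sub_apply, neg_apply,
    _root_.sum_apply, add_apply, smul_apply,
    ContinuousLinearMap.comp_apply, ContinuousLinearMap.proj_apply,
    ContinuousLinearMap.coe_fst', ContinuousLinearMap.coe_snd', smul_eq_mul]
  congr 1
  · congr 1
    refine Finset.sum_congr rfl fun i _ => ?_
    ring
  · ring

theorem fderiv_vertical {n : ℕ} (L : E17 n → ℝ) (x : E17 n) (a : Fin n → ℝ) (b : ℝ) :
    fderiv ℝ L x (0, 0, a, b) =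
      ∑ i, dLv17 n L i x * a i + b * fderiv ℝ L x (0, 0, 0, 1) := by
  have h : ((0, 0, a, b) : E17 n) =
      ∑ i, a i • ((0, 0, Pi.single i 1, 0) : E17 n) + b • ((0, 0, 0, 1) : E17 n) := by
    ext j <;> simp [Prod.fst_sum, Prod.snd_sum, Pi.single_apply]
  simp only [h, map_add, map_sum, map_smul, smul_eq_mul, dLv17, mul_comm]

theorem etaCheck19_apply_eq_zero {n : ℕ} {L : E17 n → ℝ} {x : E19 n}
    (hL : DifferentiableAt ℝ L x.1) (hp : ∀ i, x.2.1 i = dLv17 n L i x.1)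
    (hs : fderiv ℝ L x.1 (0, 0, 0, 1) ≠ 0) {R : E19 n}
    (hR : ∀ v : E19 n, extd1 (etaCheck19 n L) x R v = 0) : etaCheck19 n L x R = 0 := by
  obtain ⟨⟨Rt, Rq, Rv, Rs⟩, Rp, Rps⟩ := R
  simp only [extd1, fderiv_etaCheck19_apply hL] at hR
  obtain rfl : Rt = 0 := by
    simpa [hs] using hR ((0, 0, 0, 1), 0, 0)
  obtain rfl : Rq = 0 := by
    funext i
    simpa [Pi.single_apply] using hR ((0, 0, 0, 0), Pi.single i 1, 0)
  obtain rfl : Rp = 0 := by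
    funext i
    simpa [Pi.single_apply] using hR ((0, Pi.single i 1, 0, 0), 0, 0)
  obtain rfl : Rs = 0 := by
    have h := hR ((1, 0, 0, 0), 0, 0)
    simp at h
    rw [fderiv_vertical] at h
    simpa [← hp, hs] using h
  simp [etaCheck19, kap17]

/-- At a point `x` where `pᵢ = ∂L/∂vⁱ` for all `i` and `∂L/∂s ≠ 0`, there is
no tangent vector `R` with `η̌ₓ(R) = 1` and `i_R (dη̌)ₓ = 0`; in particular, `η̌` has no Reeb
vector field on any neighbourhood of such a point, so it is not precontact there. -/
theorem no_reeb_vector (n : ℕ) (L : E17 n → ℝ) (hL : ContDiff ℝ ∞ L)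
    (x : E19 n)
    (hp : ∀ i, x.2.1 i = dLv17 n L i x.1)
    (hs : fderiv ℝ L x.1 ((0 : ℝ), (0 : Fin n → ℝ), (0 : Fin n → ℝ), (1 : ℝ)) ≠ 0) :
    (¬ ∃ R : E19 n, etaCheck19 n L x R = 1 ∧
        ∀ v : E19 n, extd1 (etaCheck19 n L) x R v = 0) ∧
      ∀ U ∈ nhds x, ¬ ∃ R : E19 n → E19 n, ∀ y ∈ U,
        etaCheck19 n L y (R y) = 1 ∧ ∀ v : E19 n, extd1 (etaCheck19 n L) y (R y) v = 0 := by
  have hpt : ¬ ∃ R : E19 n, etaCheck19 n L x R = 1 ∧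
      ∀ v : E19 n, extd1 (etaCheck19 n L) x R v = 0 := by
    rintro ⟨R, h1, hR⟩
    have h0 := etaCheck19_apply_eq_zero (hL.differentiable (by simp) x.1) hp hs hR
    exact zero_ne_one (h0.symm.trans h1)
  exact ⟨hpt, fun U hU ⟨R, hR⟩ => hpt ⟨R x, hR x (mem_of_mem_nhds hU)⟩⟩

end VPGeom
end
end
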